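/- Let F be a nonempty finite family of strong Pouna sets satisfying constraints (C1)–(C5). Then (F, ≺, ↷) is a Burling set: ≺ restricted to F is a strict partial order, ↷ restricted to F has no directed cycles, and axioms (A1)–(A4) hold on F. -/

import Mathlib

open Set

noncomputable def lS (S : Set (ℝ × ℝ)) : ℝ := sInf (Prod.fst '' S)
noncomputable def rS (S : Set (ℝ × ℝ)) : ℝ := sSup (Prod.fst '' S)
noncomputable def bS (S : Set (ℝ × ℝ)) : ℝ := sInf (Prod.snd '' S)
noncomputable def tS (S : Set (ℝ × ℝ)) : ℝ := sSup (Prod.snd '' S)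

/-- The bounding box of a bounded set in the plane. -/
noncomputable def boxS (S : Set (ℝ × ℝ)) : Set (ℝ × ℝ) :=
  Icc (lS S) (rS S) ×ˢ Icc (bS S) (tS S)

/-- A Pouna set: nonempty, compact, path-connected, not an axis-parallel rectangle. -/
def Pouna (S : Set (ℝ × ℝ)) : Prop :=
  S.Nonempty ∧ IsCompact S ∧ IsPathConnected S ∧
    ¬ ∃ a b c d : ℝ, S = Icc a b ×ˢ Icc c d

/-- The territory of a set. -/
def Ter (S : Set (ℝ × ℝ)) : Set (ℝ × ℝ) :=
  {p | p ∈ boxS S \ S ∧ ∃ x' > p.1, (x', p.2) ∈ S}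

/-- A strong Pouna set: a Pouna set with nonempty territory. -/
def Strong (S : Set (ℝ × ℝ)) : Prop := Pouna S ∧ (Ter S).Nonempty

/-- `Prec A B` (`A ≺ B`): the bounding box of `A` is inside the territory of `B`. -/
def Prec (A B : Set (ℝ × ℝ)) : Prop := boxS A ⊆ Ter B

/-- `Adj A B` (`A ↷ B`). -/
def Adj (A B : Set (ℝ × ℝ)) : Prop :=
  A ≠ B ∧ (A ∩ B).Nonempty ∧
  lS B ≤ lS A ∧ lS A < rS B ∧ rS B < rS A ∧
  bS B < bS A ∧ bS A < tS A ∧ tS A < tS B ∧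
  {p : ℝ × ℝ | p ∈ A ∧ p.1 = lS A} ⊆ Ter B

def ConstraintC1 (F : Set (Set (ℝ × ℝ))) : Prop :=
  ∀ A ∈ F, ∀ B ∈ F, A ≠ B → (A ∩ B).Nonempty → Adj A B ∨ Adj B A

def ConstraintC2 (F : Set (Set (ℝ × ℝ))) : Prop :=
  ∀ A ∈ F, ∀ B ∈ F, A ∩ B = ∅ → (A ∩ Ter B).Nonempty → Prec A B

def ConstraintC3 (F : Set (Set (ℝ × ℝ))) : Prop :=
  ∀ A ∈ F, ∀ B ∈ F, A ≠ B → (A ∩ B).Nonempty → ¬ ∃ C ∈ F, C ⊆ Ter A ∩ Ter B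

def ConstraintC4 (F : Set (Set (ℝ × ℝ))) : Prop :=
  ¬ ∃ A ∈ F, ∃ B ∈ F, ∃ C ∈ F, Prec A B ∧ Adj A C ∧ Adj B C

def ConstraintC5 (F : Set (Set (ℝ × ℝ))) : Prop :=
  ¬ ∃ A ∈ F, ∃ B ∈ F, ∃ C ∈ F, A ≠ B ∧ A ≠ C ∧ B ≠ C ∧
    (A ∩ B).Nonempty ∧ (A ∩ C).Nonempty ∧ (B ∩ C).Nonempty

/-- A compact set is contained in its bounding box. -/
theorem IsCompact.subset_boxS {S : Set (ℝ × ℝ)} (hS : IsCompact S) : S ⊆ boxS S := fun p hp =>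
  ⟨⟨csInf_le (hS.image continuous_fst).bddBelow (mem_image_of_mem _ hp),
    le_csSup (hS.image continuous_fst).bddAbove (mem_image_of_mem _ hp)⟩,
   ⟨csInf_le (hS.image continuous_snd).bddBelow (mem_image_of_mem _ hp),
    le_csSup (hS.image continuous_snd).bddAbove (mem_image_of_mem _ hp)⟩⟩

theorem Strong.subset_boxS {S : Set (ℝ × ℝ)} (hS : Strong S) : S ⊆ boxS S :=
  hS.1.2.1.subset_boxS

/-- A strong Pouna set has a leftmost point. -/
theorem Strong.exists_fst_eq_lS {S : Set (ℝ × ℝ)} (hS : Strong S) : ∃ p ∈ S, p.1 = lS S :=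
  (hS.1.2.1.image continuous_fst).sInf_mem (hS.1.1.image _)

theorem Prec.subset_ter {A B : Set (ℝ × ℝ)} (h : Prec A B) (hA : Strong A) : A ⊆ Ter B :=
  hA.subset_boxS.trans h

theorem Prec.inter_eq_empty {A B : Set (ℝ × ℝ)} (h : Prec A B) (hA : Strong A) :
    A ∩ B = ∅ :=
  eq_empty_of_forall_notMem fun _ hp => (h.subset_ter hA hp.1).1.2 hp.2

theorem Prec.irrefl {A : Set (ℝ × ℝ)} (hA : Strong A) : ¬ Prec A A := fun h => by
  obtain ⟨p, hp⟩ := hA.1.1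
  exact (h.subset_ter hA hp).1.2 hp

theorem Prec.trans {A B C : Set (ℝ × ℝ)} (h : Prec A B) (h' : Prec B C) : Prec A C :=
  fun _ hp => h' (h hp).1.1

theorem Prec.rS_lt_and_bS_le {A B : Set (ℝ × ℝ)} (h : Prec A B) (hA : Strong A)
    (hB : Strong B) : rS A < rS B ∧ bS B ≤ bS A := by
  obtain ⟨p, hp⟩ := hA.1.1
  have hbox := hA.subset_boxS hp
  have hcorner : (rS A, bS A) ∈ Ter B :=
    h ⟨⟨hbox.1.1.trans hbox.1.2, le_rfl⟩, ⟨le_rfl, hbox.2.1.trans hbox.2.2⟩⟩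
  obtain ⟨⟨hmem, -⟩, x', hx', hxB⟩ := hcorner
  exact ⟨lt_of_lt_of_le hx' (hB.subset_boxS hxB).1.2, hmem.2.1⟩

/-- If disjoint sets have a common point in their territories, then one of them meets the
territory of the other. -/
theorem inter_ter_nonempty_or {A B : Set (ℝ × ℝ)} (hA : Strong A) (hB : Strong B)
    (hAB : A ∩ B = ∅) {p : ℝ × ℝ} (hpA : p ∈ Ter A) (hpB : p ∈ Ter B) :
    (A ∩ Ter B).Nonempty ∨ (B ∩ Ter A).Nonempty := by
  obtain ⟨⟨hpA, -⟩, a, ha, haA⟩ := hpA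
  obtain ⟨⟨hpB, -⟩, b, hb, hbB⟩ := hpB
  rcases lt_trichotomy a b with hab | rfl | hab
  · exact .inl ⟨_, haA, ⟨⟨⟨hpB.1.1.trans ha.le, hab.le.trans (hB.subset_boxS hbB).1.2⟩, hpB.2⟩,
      fun h => (hAB.le ⟨haA, h⟩ :)⟩, b, hab, hbB⟩
  · exact (hAB.le ⟨haA, hbB⟩ :).elim
  · exact .inr ⟨_, hbB, ⟨⟨⟨hpA.1.1.trans hb.le, hab.le.trans (hA.subset_boxS haA).1.2⟩, hpA.2⟩,
      fun h => (hAB.le ⟨h, hbB⟩ :)⟩, a, hab, haA⟩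

theorem ConstraintC2.prec_or_prec {F : Set (Set (ℝ × ℝ))} (h2 : ConstraintC2 F)
    {A B : Set (ℝ × ℝ)} (hAF : A ∈ F) (hBF : B ∈ F) (hA : Strong A) (hB : Strong B)
    (hAB : A ∩ B = ∅) {p : ℝ × ℝ} (hpA : p ∈ Ter A) (hpB : p ∈ Ter B) :
    Prec A B ∨ Prec B A :=
  (inter_ter_nonempty_or hA hB hAB hpA hpB).imp (h2 A hAF B hBF hAB)
    (h2 B hBF A hAF (inter_comm A B ▸ hAB))

theorem Adj.rS_lt {A B : Set (ℝ × ℝ)} (h : Adj A B) : rS B < rS A := h.2.2.2.2.1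

theorem Adj.bS_lt {A B : Set (ℝ × ℝ)} (h : Adj A B) : bS B < bS A := h.2.2.2.2.2.1

/-- A nonempty finite family of strong Pouna sets satisfying (C1)-(C5), together with
`≺` and `↷`, forms a Burling set: `≺` is a strict partial order on `F`, `↷` has no
directed cycles in `F`, and axioms (A1)-(A4) hold. -/
theorem stmt_5 (F : Set (Set (ℝ × ℝ))) (hne : F.Nonempty) (hfin : F.Finite)
    (hstrong : ∀ S ∈ F, Strong S)
    (h1 : ConstraintC1 F) (h2 : ConstraintC2 F) (h3 : ConstraintC3 F)
    (h4 : ConstraintC4 F) (h5 : ConstraintC5 F) :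
    (∀ A ∈ F, ¬ Prec A A) ∧
    (∀ A ∈ F, ∀ B ∈ F, Prec A B → ¬ Prec B A) ∧
    (∀ A ∈ F, ∀ B ∈ F, ∀ C ∈ F, Prec A B → Prec B C → Prec A C) ∧
    (∀ n : ℕ, ∀ x : Fin (n + 1) → Set (ℝ × ℝ), (∀ i, x i ∈ F) →
      ¬ ((∀ i : Fin n, Adj (x i.castSucc) (x i.succ)) ∧ Adj (x (Fin.last n)) (x 0))) ∧
    (∀ x ∈ F, ∀ y ∈ F, ∀ z ∈ F, Prec x y → Prec x z → y ≠ z → Prec y z ∨ Prec z y) ∧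
    (∀ x ∈ F, ∀ y ∈ F, ∀ z ∈ F, Adj x y → Adj x z → y ≠ z → Prec y z ∨ Prec z y) ∧
    (∀ x ∈ F, ∀ y ∈ F, ∀ z ∈ F, Adj x y → Prec x z → Prec y z) ∧
    (∀ x ∈ F, ∀ y ∈ F, ∀ z ∈ F, Adj x y → Prec y z → Adj x z ∨ Prec x z) := by
  refine ⟨fun A hA => Prec.irrefl (hstrong A hA),
    fun A hA B _ hAB hBA => Prec.irrefl (hstrong A hA) (hAB.trans hBA),
    fun A _ B _ C _ hAB hBC => hAB.trans hBC, ?_, ?_, ?_, ?_, ?_⟩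
  · rintro n x - ⟨hx, hlast⟩
    have hanti : StrictAnti fun i => rS (x i) :=
      Fin.strictAnti_iff_succ_lt.2 fun i => (hx i).rS_lt
    exact (hanti.antitone (Fin.zero_le (Fin.last n))).not_gt hlast.rS_lt
  · intro x hx y hy z hz hxy hxz hyz
    have hsx := hstrong x hx
    obtain ⟨p, hp⟩ := hsx.1.1
    refine h2.prec_or_prec hy hz (hstrong y hy) (hstrong z hz) ?_
      (hxy.subset_ter hsx hp) (hxz.subset_ter hsx hp)
    by_contra hne
    exact h3 y hy z hz hyz (nonempty_iff_ne_empty.2 hne)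
      ⟨x, hx, subset_inter (hxy.subset_ter hsx) (hxz.subset_ter hsx)⟩
  · intro x hx y hy z hz hxy hxz hyz
    obtain ⟨p, hp, hpl⟩ := (hstrong x hx).exists_fst_eq_lS
    refine h2.prec_or_prec hy hz (hstrong y hy) (hstrong z hz) ?_
      (hxy.2.2.2.2.2.2.2.2 ⟨hp, hpl⟩) (hxz.2.2.2.2.2.2.2.2 ⟨hp, hpl⟩)
    by_contra hne
    exact h5 ⟨x, hx, y, hy, z, hz, hxy.1, hxz.1, hyz, hxy.2.1, hxz.2.1,
      nonempty_iff_ne_empty.2 hne⟩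
  · intro x hx y hy z hz hxy hxz
    have hsx := hstrong x hx
    obtain ⟨p, hpx, hpy⟩ := hxy.2.1
    have hpz := hxz.subset_ter hsx hpx
    by_cases hyz : y ∩ z = ∅
    · exact h2 y hy z hz hyz ⟨p, hpy, hpz⟩
    have hne : y ≠ z := by
      rintro rfl
      exact hpz.1.2 hpy
    rcases h1 y hy z hz hne (nonempty_iff_ne_empty.2 hyz) with h | h
    · exact ((h.rS_lt.trans hxy.rS_lt).trans
        (hxz.rS_lt_and_bS_le hsx (hstrong z hz)).1).false.elim
    · exact (h4 ⟨x, hx, z, hz, y, hy, hxz, hxy, h⟩).elim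
  · intro x hx y hy z hz hxy hyz
    have hsy := hstrong y hy
    obtain ⟨p, hpx, hpy⟩ := hxy.2.1
    have hpz := hyz.subset_ter hsy hpy
    by_cases hxz : x ∩ z = ∅
    · exact .inr (h2 x hx z hz hxz ⟨p, hpx, hpz⟩)
    have hne : x ≠ z := by
      rintro rfl
      exact hpz.1.2 hpx
    rcases h1 x hx z hz hne (nonempty_iff_ne_empty.2 hxz) with h | h
    · exact .inl h
    · exact (((hyz.rS_lt_and_bS_le hsy (hstrong z hz)).2.trans_lt hxy.bS_lt).trans
        h.bS_lt).false.elim
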